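/- arXiv:2304.10917 — 8 statements merged into one kernel-verified Lean document; each statement's English description precedes it below -/
import Mathlib

section
/- Fix integers n ≥ 0 and L ≥ 1. Any two Austrian partitions in 𝒜(n,L) eventually reach the same periodic cycle under iteration of the Austrian Solitaire map A; that is, for all λ, μ ∈ 𝒜(n,L) there exist integers a, b ≥ 0 with A^a(λ) = A^b(μ). In particular, 𝒜(n,L) contains exactly one periodic cycle of A. -/
/-- Total number of non-bank parts: `t(λ) = ∑_{m=1}^L f_m(λ)`.
A state `σ : ℕ → ℕ` encodes an Austrian partition by its bank deposit `σ 0`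
and its part-frequencies `σ m = f_m` for `1 ≤ m ≤ L`. -/
def austrianT (L : ℕ) (σ : ℕ → ℕ) : ℕ := ∑ m ∈ Finset.Icc 1 L, σ m

/-- The Austrian Solitaire map `A` on frequency encodings:
`f_m(A λ) = f_{m+1}(λ)` for `1 ≤ m ≤ L-1`, `f_L(A λ) = ⌊(λ₀ + t(λ))/L⌋`,
and bank deposit `(λ₀ + t(λ)) mod L`. -/
def austrianStep (L : ℕ) (σ : ℕ → ℕ) : ℕ → ℕ := fun m =>
  if m = 0 then (σ 0 + austrianT L σ) % L
  else if m = L then (σ 0 + austrianT L σ) / L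
  else if m < L then σ (m + 1)
  else 0

/-- `σ` encodes an Austrian partition of `n` with bank capacity `L`:
bank deposit `σ 0 < L`, no parts of size `> L`, and total value `n`. -/
def IsAustrian (n L : ℕ) (σ : ℕ → ℕ) : Prop :=
  σ 0 < L ∧ (∀ m, L < m → σ m = 0) ∧ σ 0 + ∑ m ∈ Finset.Icc 1 L, m * σ m = n

/-- `σ` is periodic under the Austrian Solitaire map: `A^P σ = σ` for some `P ≥ 1`. -/
def IsAustrianPeriodic (L : ℕ) (σ : ℕ → ℕ) : Prop :=
  ∃ P, 1 ≤ P ∧ (austrianStep L)^[P] σ = σ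

open Finset

/-- `C` records cumulative stack counts of an orbit: the bank deposit
`n + ∑_{i<L} C (s+i) - L * C (s+L)` always lies in `[0, L)`. -/
def IsCumulative (n L : ℕ) (C : ℕ → ℤ) : Prop :=
  ∀ s, 0 ≤ n + ∑ i ∈ range L, C (s + i) - L * C (s + L) ∧
    n + ∑ i ∈ range L, C (s + i) - L * C (s + L) < L

theorem IsCumulative.shift {n L : ℕ} {C : ℕ → ℤ} (h : IsCumulative n L C) (a : ℕ) :
    IsCumulative n L (fun s => C (s + a)) := by
  intro s
  have := h (s + a)
  simpa only [add_right_comm] using this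

theorem IsCumulative.sum_sub_le {n L : ℕ} {C D : ℕ → ℤ} (hC : IsCumulative n L C)
    (hD : IsCumulative n L D) (s : ℕ) :
    ∑ i ∈ range L, (C (s + i) - D (s + i)) ≤ L * (C (s + L) - D (s + L)) + (L - 1) := by
  have h1 := hC s
  have h2 := hD s
  rw [sum_sub_distrib, mul_sub]
  omega

theorem apply_add_mul_of_apply_add {C : ℕ → ℤ} {P : ℕ} {Q : ℤ} (h : ∀ s, C (s + P) = C s + Q)
    (k s : ℕ) : C (s + k * P) = C s + k * Q := by
  induction k with
  | zero => simp
  | succ k ih =>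
    rw [Nat.succ_mul, ← add_assoc, h, ih]
    push_cast
    ring

theorem sum_shift_of_apply_add {C : ℕ → ℤ} {P : ℕ} {Q : ℤ} (h : ∀ s, C (s + P) = C s + Q)
    (a : ℕ) : ∑ u ∈ range P, C (u + a) = ∑ u ∈ range P, C u + a * Q := by
  induction a with
  | zero => simp
  | succ a ih =>
    have h1 := sum_range_succ (fun u => C (u + a)) P
    have h2 := sum_range_succ' (fun u => C (u + a)) P
    have h3 := h a
    rw [add_comm a P] at h3
    simp only [add_right_comm _ 1 a, zero_add] at h2
    simp only [← add_assoc]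
    simp only [add_right_comm _ a 1] at *
    push_cast
    linarith

/-- If the increments of `X` over a period are nonnegative, some interval has least increment. -/
theorem exists_least_increment {X : ℕ → ℤ} {P : ℕ} {μ : ℤ} (hP : 0 < P) (hμ : 0 ≤ μ)
    (hX : ∀ s, X (s + P) = X s + μ) :
    ∃ s₀ d₀, ∀ s d, X (s₀ + d₀) - X s₀ ≤ X (s + d) - X s := by
  obtain ⟨⟨s₀, d₀⟩, -, hmin⟩ := exists_min_image (range P ×ˢ range P)
    (fun p => X (p.1 + p.2) - X p.1) ⟨(0, 0), by simp [hP]⟩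
  refine ⟨s₀, d₀, fun s d => ?_⟩
  have h := hmin (s % P, d % P) (by simp [Nat.mod_lt _ hP])
  have h1 := apply_add_mul_of_apply_add hX (s / P) (s % P)
  have h2 := apply_add_mul_of_apply_add hX (s / P + d / P) (s % P + d % P)
  have e1 : s % P + s / P * P = s := Nat.mod_add_div' s P
  have e2 : d % P + d / P * P = d := Nat.mod_add_div' d P
  have e3 : s % P + d % P + (s / P + d / P) * P = s + d := by rw [add_mul]; omega
  rw [e1] at h1
  rw [e3] at h2
  have h3 : 0 ≤ ((d / P : ℕ) : ℤ) * μ := by positivity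
  simp only at h
  rw [h1, h2]
  push_cast at *
  linarith

/-- A periodic integer sequence whose terms are never rounded below the floor of the average of
the preceding `L` terms stays within one unit below its mean. -/
theorem sum_lt_of_round {E : ℕ → ℤ} {L P : ℕ} (hP : 0 < P)
    (hper : ∀ s, E (s + P) = E s)
    (hE : ∀ s, ∑ i ∈ range L, E (s + i) ≤ L * E (s + L) + (L - 1)) (u : ℕ) :
    ∑ i ∈ range P, E i < P * (E u + 1) := by
  classical
  by_contra! hcon
  set κ := E u + 1 with hκ
  let X : ℕ → ℤ := fun s => ∑ i ∈ range s, (E i - κ)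
  have hXadd (s d : ℕ) : X (s + d) = X s + ∑ i ∈ range d, (E (s + i) - κ) :=
    sum_range_add (fun i => E i - κ) s d
  have hXsucc (s : ℕ) : X (s + 1) = X s + (E s - κ) := by simp [hXadd]
  have hXP (s : ℕ) : X (s + P) = X s + ∑ i ∈ range P, (E i - κ) := by
    have := sum_shift_of_apply_add (C := fun i => E i - κ) (Q := 0) (P := P) (by simp [hper]) s
    rw [hXadd]
    simp only [add_comm s]
    linarith
  have hμ : 0 ≤ ∑ i ∈ range P, (E i - κ) := by
    rw [sum_sub_distrib]
    simp
    linarith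
  obtain ⟨s₀, d₀, hmin⟩ := exists_least_increment hP hμ hXP
  have hex : ∃ d s, X (s + d) - X s = X (s₀ + d₀) - X s₀ := ⟨d₀, s₀, rfl⟩
  have hneg : X (s₀ + d₀) - X s₀ < 0 := by
    have := hmin u 1
    rw [hXsucc] at this
    linarith
  obtain ⟨s, hs⟩ := Nat.find_spec hex
  have hlt (m : ℕ) (hm : m < Nat.find hex) := Nat.find_min hex hm
  generalize Nat.find hex = d at hs hlt
  obtain _ | d := d
  · simp only [add_zero, sub_self] at hs
    linarith
  have hEs : E s < κ := by
    have h1 := hmin (s + 1) d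
    have h2 : X (s + 1 + d) - X (s + 1) ≠ X (s₀ + d₀) - X s₀ :=
      fun h => hlt d (Nat.lt_succ_self d) ⟨s + 1, h⟩
    have h3 : s + (d + 1) = s + 1 + d := by ring
    have h4 := hXsucc s
    rw [h3] at hs
    have h5 := lt_of_le_of_ne h1 h2.symm
    linarith
  obtain ⟨r, hr⟩ : ∃ r, s + L * P = r + L := ⟨s + L * P - L, by
    have := Nat.le_mul_of_pos_right L hP
    omega⟩
  have h1 := apply_add_mul_of_apply_add hXP L s
  have h2 := apply_add_mul_of_apply_add hXP L (s + (d + 1))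
  have h3 := apply_add_mul_of_apply_add (C := E) (Q := 0) (P := P) (by simp [hper]) L s
  rw [hr] at h1 h3
  have h4 : s + (d + 1) + L * P = r + (L + (d + 1)) := by omega
  rw [h4] at h2
  have h5 := hmin r (L + (d + 1))
  have h6 := hXadd r L
  have h7 := hE r
  rw [sum_sub_distrib] at h6
  simp at h6
  have h8 : (L : ℤ) * E (r + L) ≤ L * (κ - 1) :=
    mul_le_mul_of_nonneg_left (by omega) (by positivity)
  linarith

theorem IsCumulative.sub_eq_of_sum_eq {n L P : ℕ} {C D : ℕ → ℤ} {Q k : ℤ}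
    (hC : IsCumulative n L C) (hD : IsCumulative n L D) (hP : 0 < P)
    (hCP : ∀ s, C (s + P) = C s + Q) (hDP : ∀ s, D (s + P) = D s + Q)
    (hsum : ∑ u ∈ range P, (C u - D u) = P * k) (s : ℕ) : C s - D s = k := by
  have hP' : (0 : ℤ) < P := by exact_mod_cast hP
  have h1 := sum_lt_of_round (E := fun s => C s - D s) hP (by simp [hCP, hDP])
    (hC.sum_sub_le hD) s
  have h2 := sum_lt_of_round (E := fun s => D s - C s) hP (by simp [hCP, hDP])
    (hD.sum_sub_le hC) s
  have h3 : ∑ u ∈ range P, (D u - C u) = P * -k := by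
    rw [mul_neg, ← hsum, ← sum_neg_distrib]
    simp
  rw [hsum] at h1
  rw [h3] at h2
  have h4 := lt_of_mul_lt_mul_left h1 hP'.le
  have h5 := lt_of_mul_lt_mul_left h2 hP'.le
  linarith

theorem IsCumulative.exists_sub_le {n L : ℕ} {C D : ℕ → ℤ} (hL : 0 < L)
    (hC : IsCumulative n L C) (hD : IsCumulative n L D) : ∃ M, ∀ s, D s - C s ≤ M := by
  refine ⟨∑ i ∈ range L, |D i - C i|, fun s => ?_⟩
  set M := ∑ i ∈ range L, |D i - C i|
  induction s using Nat.strong_induction_on with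
  | _ s ih =>
    obtain h | h := lt_or_ge s L
    · exact (le_abs_self _).trans
        (single_le_sum (f := fun i => |D i - C i|) (fun i _ => abs_nonneg _) (mem_range.2 h))
    obtain ⟨r, rfl⟩ := Nat.exists_eq_add_of_le' h
    have h1 := hC.sum_sub_le hD r
    have h2 : ∑ i ∈ range L, (D (r + i) - C (r + i)) ≤ ∑ _i ∈ range L, M :=
      sum_le_sum fun i hi => ih _ (by have := mem_range.1 hi; omega)
    have h3 : ∑ i ∈ range L, (C (r + i) - D (r + i)) =
        -∑ i ∈ range L, (D (r + i) - C (r + i)) := by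
      rw [← sum_neg_distrib]
      simp
    simp only [sum_const, card_range, nsmul_eq_mul] at h2
    have hL' : (0 : ℤ) < L := by exact_mod_cast hL
    have h4 : (L : ℤ) * (D (r + L) - C (r + L)) < L * (M + 1) := by linarith
    have h5 := lt_of_mul_lt_mul_left h4 hL'.le
    omega

theorem IsCumulative.rate_le {n L P : ℕ} {C D : ℕ → ℤ} {Q R : ℤ} (hL : 0 < L)
    (hC : IsCumulative n L C) (hD : IsCumulative n L D)
    (hCP : ∀ s, C (s + P) = C s + Q) (hDP : ∀ s, D (s + P) = D s + R) : R ≤ Q := by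
  by_contra! h
  obtain ⟨M, hM⟩ := hC.exists_sub_le hL hD
  let k := (M - (D 0 - C 0) + 1).toNat
  have hk : M - (D 0 - C 0) + 1 ≤ k := Int.self_le_toNat _
  have h1 := hM (0 + k * P)
  rw [apply_add_mul_of_apply_add hCP, apply_add_mul_of_apply_add hDP] at h1
  have h2 : (k : ℤ) * 1 ≤ k * (R - Q) :=
    mul_le_mul_of_nonneg_left (by omega) (by positivity)
  linarith

theorem IsCumulative.apply_add_div_gcd {n L P g p : ℕ} {C : ℕ → ℤ} {q : ℤ}
    (hC : IsCumulative n L C) (hP : 0 < P) (hp : P = g * p)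
    (hCP : ∀ s, C (s + P) = C s + g * q) (s : ℕ) : C (s + p) = C s + q := by
  have h := (hC.shift p).sub_eq_of_sum_eq hC hP (Q := g * q) (k := q)
    (fun s => by rw [add_right_comm, hCP]) hCP (by
      rw [sum_sub_distrib, sum_shift_of_apply_add hCP, hp]
      push_cast
      ring) s
  linarith

/-- Two cumulative sequences with a common period agree up to shift and translation. -/
theorem IsCumulative.exists_shift {n L P : ℕ} {C D : ℕ → ℤ} {Q R : ℤ} (hL : 0 < L)
    (hC : IsCumulative n L C) (hD : IsCumulative n L D) (hP : 0 < P)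
    (hCP : ∀ s, C (s + P) = C s + Q) (hDP : ∀ s, D (s + P) = D s + R) :
    ∃ (a : ℕ) (k : ℤ), ∀ s, C (s + a) = D s + k := by
  obtain rfl : Q = R := le_antisymm (hD.rate_le hL hC hDP hCP) (hC.rate_le hL hD hCP hDP)
  have hg : 0 < Int.gcd (P : ℤ) Q := Int.gcd_pos_of_ne_zero_left _ (by exact_mod_cast hP.ne')
  obtain ⟨g, hgdef⟩ : ∃ g, g = Int.gcd (P : ℤ) Q := ⟨_, rfl⟩
  rw [← hgdef] at hg
  obtain ⟨p, hp⟩ : g ∣ P := by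
    rw [hgdef]
    exact_mod_cast Int.gcd_dvd_left (P : ℤ) Q
  obtain ⟨q, rfl⟩ : (g : ℤ) ∣ Q := hgdef ▸ Int.gcd_dvd_right (P : ℤ) Q
  have hp0 : 0 < p := Nat.pos_of_ne_zero (by rintro rfl; omega)
  have hcop : IsCoprime (p : ℤ) q := by
    rw [Int.isCoprime_iff_gcd_eq_one]
    have h : g = Int.gcd ((g : ℤ) * p) (g * q) := by
      rw [← Nat.cast_mul, ← hp]
      exact hgdef
    rw [Int.gcd_mul_left, Int.natAbs_natCast] at h
    exact (Nat.mul_right_cancel_iff hg).1 (by linarith)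
  have hCp := hC.apply_add_div_gcd hP hp hCP
  have hDp := hD.apply_add_div_gcd hP hp hDP
  obtain ⟨x, y, hxy⟩ := hcop
  let r := ∑ u ∈ range p, D u - ∑ u ∈ range p, C u
  have hp0' : (p : ℤ) ≠ 0 := by exact_mod_cast hp0.ne'
  obtain ⟨a, ha⟩ : ∃ a : ℕ, (a : ℤ) = (r * y) % p :=
    ⟨((r * y) % p).toNat, Int.toNat_of_nonneg (Int.emod_nonneg _ hp0')⟩
  have ha' := Int.mul_ediv_add_emod (r * y) p
  refine ⟨a, -(r * x + r * y / p * q), fun s => ?_⟩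
  have h := (hC.shift a).sub_eq_of_sum_eq hD hp0 (Q := q) (k := -(r * x + r * y / p * q))
    (fun s => by rw [add_right_comm, hCp]) hDp (by
      rw [sum_sub_distrib, sum_shift_of_apply_add hCp, ha]
      have : ∑ u ∈ range p, C u = ∑ u ∈ range p, D u - r := by ring
      rw [this]
      linear_combination q * ha' + r * hxy) s
  linarith

theorem sum_Icc_one (L : ℕ) (f : ℕ → ℕ) : ∑ m ∈ Icc 1 L, f m = ∑ i ∈ range L, f (i + 1) := by
  rw [range_eq_Ico, sum_Ico_add' f 0 L 1]
  rfl

theorem IsAustrian.step {n L : ℕ} {σ : ℕ → ℕ} (hL : 1 ≤ L) (h : IsAustrian n L σ) :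
    IsAustrian n L (austrianStep L σ) := by
  obtain ⟨-, -, h2⟩ := h
  obtain ⟨K, rfl⟩ := Nat.exists_eq_add_of_le' hL
  refine ⟨?_, ?_, ?_⟩
  · simpa [austrianStep] using Nat.mod_lt _ hL
  · intro m hm
    simp only [austrianStep]
    split_ifs <;> omega
  · have hT : austrianT (K + 1) σ = ∑ i ∈ range (K + 1), σ (i + 1) := sum_Icc_one _ σ
    have hdiv := Nat.div_add_mod (σ 0 + austrianT (K + 1) σ) (K + 1)
    have h0 : austrianStep (K + 1) σ 0 = (σ 0 + austrianT (K + 1) σ) % (K + 1) := by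
      simp [austrianStep]
    have hlast : austrianStep (K + 1) σ (K + 1) = (σ 0 + austrianT (K + 1) σ) / (K + 1) := by
      simp [austrianStep]
    have hmid : ∑ i ∈ range K, (i + 1) * austrianStep (K + 1) σ (i + 1) =
        ∑ i ∈ range K, (i + 1) * σ (i + 1 + 1) :=
      sum_congr rfl fun i hi => by
        have := mem_range.1 hi
        simp [austrianStep, this, this.ne]
    have hweight : ∑ i ∈ range (K + 1), (i + 1) * σ (i + 1) =
        ∑ i ∈ range K, (i + 1) * σ (i + 1 + 1) + ∑ i ∈ range (K + 1), σ (i + 1) := by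
      simp only [add_one_mul, sum_add_distrib]
      rw [sum_range_succ' (fun i => i * σ (i + 1))]
      simp [add_one_mul, sum_add_distrib]
    rw [sum_Icc_one] at h2 ⊢
    rw [sum_range_succ, hmid, h0, hlast]
    omega

theorem IsAustrian.iterate {n L : ℕ} {σ : ℕ → ℕ} (hL : 1 ≤ L) (h : IsAustrian n L σ) (s : ℕ) :
    IsAustrian n L ((austrianStep L)^[s] σ) := by
  induction s with
  | zero => exact h
  | succ s ih => rw [Function.iterate_succ_apply']; exact ih.step hL

theorem austrianStep_iterate_add_apply (L : ℕ) (σ : ℕ → ℕ) (s k m : ℕ) (hm : 1 ≤ m)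
    (hk : m + k = L) : (austrianStep L)^[s + k] σ m = (austrianStep L)^[s] σ L := by
  induction k generalizing m with
  | zero => rw [← hk]; rfl
  | succ k ih =>
    rw [← add_assoc, Function.iterate_succ_apply', ← ih (m + 1) (by omega) (by omega)]
    simp only [austrianStep]
    rw [if_neg (by omega), if_neg (by omega), if_pos (by omega)]

theorem austrianStep_iterate_add_self_apply (L : ℕ) (σ : ℕ → ℕ) (s m : ℕ) (hm : 1 ≤ m)
    (hmL : m ≤ L) : (austrianStep L)^[s + L] σ m = (austrianStep L)^[s + m] σ L := by
  rw [← austrianStep_iterate_add_apply L σ (s + m) (L - m) m hm (by omega)]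
  rw [add_assoc, Nat.add_sub_cancel' hmL]

/-- Number of stacks of size `L` created up to time `s` along the orbit of `σ`. -/
def austrianCumul (L : ℕ) (σ : ℕ → ℕ) (s : ℕ) : ℤ :=
  ∑ u ∈ range (s + 1), ((austrianStep L)^[u] σ L : ℤ)

theorem austrianCumul_succ (L : ℕ) (σ : ℕ → ℕ) (s : ℕ) :
    austrianCumul L σ (s + 1) = austrianCumul L σ s + ((austrianStep L)^[s + 1] σ L : ℤ) :=
  sum_range_succ _ _

theorem sum_mul_austrianStep_iterate (L : ℕ) (σ : ℕ → ℕ) (s K : ℕ) :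
    ∑ i ∈ range K, ((i : ℤ) + 1) * ((austrianStep L)^[s + (i + 1)] σ L : ℤ) =
      K * austrianCumul L σ (s + K) - ∑ i ∈ range K, austrianCumul L σ (s + i) := by
  induction K with
  | zero => simp
  | succ K ih =>
    rw [sum_range_succ, sum_range_succ, ih, ← add_assoc s K 1, austrianCumul_succ]
    push_cast
    ring

theorem IsAustrian.isCumulative {n L : ℕ} {σ : ℕ → ℕ} (hL : 1 ≤ L) (h : IsAustrian n L σ) :
    IsCumulative n L (austrianCumul L σ) := by
  intro s
  obtain ⟨hb, -, hn⟩ := h.iterate hL (s + L)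
  have h1 := sum_mul_austrianStep_iterate L σ s L
  rw [sum_Icc_one] at hn
  have h2 : ∑ i ∈ range L, (i + 1) * (austrianStep L)^[s + L] σ (i + 1) =
      ∑ i ∈ range L, (i + 1) * (austrianStep L)^[s + (i + 1)] σ L :=
    sum_congr rfl fun i hi => by
      have := mem_range.1 hi
      rw [austrianStep_iterate_add_self_apply L σ s (i + 1) (by omega) (by omega)]
  rw [h2] at hn
  zify at hn hb
  rw [h1] at hn
  have h0 : (0 : ℤ) ≤ (austrianStep L)^[s + L] σ 0 := Int.natCast_nonneg _
  constructor <;> linarith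

theorem exists_austrianCumul_add {L P : ℕ} {σ : ℕ → ℕ} (hP : (austrianStep L)^[P] σ = σ) :
    ∃ Q : ℤ, ∀ s, austrianCumul L σ (s + P) = austrianCumul L σ s + Q := by
  refine ⟨austrianCumul L σ P - austrianCumul L σ 0, fun s => ?_⟩
  induction s with
  | zero => simp
  | succ s ih =>
    rw [add_right_comm, austrianCumul_succ, austrianCumul_succ, ih, add_right_comm s P 1,
      Function.iterate_add_apply _ (s + 1) P, hP]
    ring

theorem IsAustrian.ext {n L : ℕ} {σ τ : ℕ → ℕ} (hσ : IsAustrian n L σ) (hτ : IsAustrian n L τ)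
    (h : ∀ m, 1 ≤ m → m ≤ L → σ m = τ m) : σ = τ := by
  have hsum : ∑ m ∈ Icc 1 L, m * σ m = ∑ m ∈ Icc 1 L, m * τ m :=
    sum_congr rfl fun m hm => by rw [h m (mem_Icc.1 hm).1 (mem_Icc.1 hm).2]
  obtain ⟨-, hσ1, hσ2⟩ := hσ
  obtain ⟨-, hτ1, hτ2⟩ := hτ
  funext m
  obtain rfl | hm := Nat.eq_zero_or_pos m
  · omega
  obtain hmL | hmL := le_or_gt m L
  · exact h m hm hmL
  · rw [hσ1 m hmL, hτ1 m hmL]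

theorem IsAustrianPeriodic.exists_iterate_eq {n L : ℕ} {σ τ : ℕ → ℕ} (hL : 1 ≤ L)
    (hσ : IsAustrian n L σ) (hτ : IsAustrian n L τ) (hσP : IsAustrianPeriodic L σ)
    (hτP : IsAustrianPeriodic L τ) : ∃ a : ℕ, (austrianStep L)^[a] σ = τ := by
  obtain ⟨P₁, hP₁, h₁⟩ := hσP
  obtain ⟨P₂, hP₂, h₂⟩ := hτP
  have hP : 0 < P₁ * P₂ := Nat.mul_pos hP₁ hP₂
  have hσ' : (austrianStep L)^[P₁ * P₂] σ = σ := Function.IsPeriodicPt.mul_const h₁ P₂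
  have hτ' : (austrianStep L)^[P₁ * P₂] τ = τ := Function.IsPeriodicPt.const_mul h₂ P₁
  obtain ⟨Q, hQ⟩ := exists_austrianCumul_add hσ'
  obtain ⟨R, hR⟩ := exists_austrianCumul_add hτ'
  obtain ⟨a, k, hak⟩ := (hσ.isCumulative hL).exists_shift hL (hτ.isCumulative hL) hP hQ hR
  have hstack (s : ℕ) :
      (austrianStep L)^[a + (s + 1)] σ L = (austrianStep L)^[s + 1] τ L := by
    have h3 := hak s
    have h4 := hak (s + 1)
    rw [add_right_comm, austrianCumul_succ, austrianCumul_succ] at h4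
    rw [show a + (s + 1) = s + a + 1 by ring]
    zify
    linarith
  have hmeet : (austrianStep L)^[a + L] σ = (austrianStep L)^[0 + L] τ := by
    refine (hσ.iterate hL _).ext (hτ.iterate hL _) fun m hm hmL => ?_
    rw [austrianStep_iterate_add_self_apply L σ a m hm hmL,
      austrianStep_iterate_add_self_apply L τ 0 m hm hmL]
    obtain ⟨s, rfl⟩ := Nat.exists_eq_add_of_le' hm
    rw [hstack, zero_add]
  have hle : L ≤ P₁ * P₂ * L := Nat.le_mul_of_pos_left L hP
  refine ⟨P₁ * P₂ * L - L + (a + L), ?_⟩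
  rw [Function.iterate_add_apply, hmeet, ← Function.iterate_add_apply,
    show P₁ * P₂ * L - L + (0 + L) = P₁ * P₂ * L by omega]
  exact Function.IsPeriodicPt.mul_const hτ' L

theorem finite_setOf_isAustrian (n L : ℕ) : {σ | IsAustrian n L σ}.Finite := by
  refine Set.Finite.of_finite_image (f := fun σ (i : Fin (L + 1)) => σ i)
    ((Set.finite_Icc (0 : Fin (L + 1) → ℕ) (fun _ => n)).subset ?_) ?_
  · rintro _ ⟨σ, ⟨-, -, hn⟩, rfl⟩
    refine ⟨fun i => Nat.zero_le _, fun i => ?_⟩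
    obtain hi | hi := Nat.eq_zero_or_pos (i : ℕ)
    · simp only [hi]
      omega
    · have h1 := single_le_sum (f := fun m => m * σ m) (fun m _ => Nat.zero_le _)
        (mem_Icc.2 ⟨Nat.one_le_iff_ne_zero.2 hi.ne', Nat.lt_succ_iff.1 i.2⟩)
      have h2 := Nat.le_mul_of_pos_left (σ i) hi
      simp only at h1 ⊢
      omega
  · intro σ hσ τ hτ h
    exact IsAustrian.ext hσ hτ fun m _ hmL => congrFun h ⟨m, Nat.lt_succ_of_le hmL⟩

theorem IsAustrian.exists_isAustrianPeriodic_iterate {n L : ℕ} {σ : ℕ → ℕ} (hL : 1 ≤ L)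
    (hσ : IsAustrian n L σ) : ∃ s, IsAustrianPeriodic L ((austrianStep L)^[s] σ) := by
  obtain ⟨s, t, hst, h⟩ := Set.Finite.exists_lt_map_eq_of_forall_mem
    (fun s => hσ.iterate hL s) (finite_setOf_isAustrian n L)
  refine ⟨s, t - s, by omega, ?_⟩
  rw [← Function.iterate_add_apply, Nat.sub_add_cancel hst.le]
  exact h.symm

/-- **Austrian Solitaire has a unique cycle.**  Fix `n ≥ 0` and `L ≥ 1`.  Any two
Austrian partitions in `𝒜(n,L)` eventually reach the same periodic cycle under
iteration of `A`: there are `a, b ≥ 0` with `A^a λ = A^b μ`.  In particular any two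
periodic partitions lie on the same cycle, i.e. `𝒜(n,L)` has exactly one cycle. -/
theorem austrian_unique_cycle (n L : ℕ) (hL : 1 ≤ L) :
    (∀ σ τ : ℕ → ℕ, IsAustrian n L σ → IsAustrian n L τ →
      ∃ a b : ℕ, (austrianStep L)^[a] σ = (austrianStep L)^[b] τ) ∧
    (∀ σ τ : ℕ → ℕ, IsAustrian n L σ → IsAustrian n L τ →
      IsAustrianPeriodic L σ → IsAustrianPeriodic L τ →
      ∃ a : ℕ, (austrianStep L)^[a] σ = τ) := by
  have main := fun σ τ (hσ : IsAustrian n L σ) (hτ : IsAustrian n L τ) =>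
    IsAustrianPeriodic.exists_iterate_eq hL hσ hτ
  refine ⟨fun σ τ hσ hτ => ?_, main⟩
  obtain ⟨s, hs⟩ := hσ.exists_isAustrianPeriodic_iterate hL
  obtain ⟨t, ht⟩ := hτ.exists_isAustrianPeriodic_iterate hL
  obtain ⟨a, ha⟩ := main _ _ (hσ.iterate hL s) (hτ.iterate hL t) hs ht
  exact ⟨a + s, t, by rw [Function.iterate_add_apply, ha]⟩
end

section
/- Let L ≥ 1 and let q ≥ 0, 1 ≤ p ≤ L be coprime integers. Let b be an integer with 0 ≤ b < ⌊L/p⌋, and let λ be the Austrian partition with bank deposit λ_0 = b and f_m(λ) = ⌈(q/p)(L−m+1)⌉ − ⌈(q/p)(L−m)⌉ for 1 ≤ m ≤ L, so λ ∈ 𝒜(n,L) for n = b + ∑_{m=1}^L m·f_m(λ). Then λ is periodic under the Austrian Solitaire map: A^p(λ) = λ. -/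
/-- The frequency profile of the maximal balanced partition for ratio `r`:
`f_m = ⌈r·(L-m+1)⌉ - ⌈r·(L-m)⌉` for `1 ≤ m ≤ L`. -/
def maximalFreq (L : ℕ) (r : ℚ) (m : ℕ) : ℕ :=
  (⌈r * ((L : ℚ) - (m : ℚ) + 1)⌉ - ⌈r * ((L : ℚ) - (m : ℚ))⌉).toNat

/-- The Austrian partition with bank deposit `b` and frequencies
`f_m = ⌈r(L-m+1)⌉ - ⌈r(L-m)⌉` for `1 ≤ m ≤ L`. -/
def balancedPartition (L : ℕ) (r : ℚ) (b : ℕ) : ℕ → ℕ := fun m =>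
  if m = 0 then b else if m ≤ L then maximalFreq L r m else 0

/-- The integer sequence `j ↦ ⌈r * j⌉`. -/
def ceilMul (r : ℚ) (j : ℤ) : ℤ := ⌈r * (j : ℚ)⌉

lemma ceilMul_zero (r : ℚ) : ceilMul r 0 = 0 := by simp [ceilMul]

lemma ceilMul_mono {r : ℚ} (hr : 0 ≤ r) : Monotone (ceilMul r) := fun _ _ h =>
  Int.ceil_mono (mul_le_mul_of_nonneg_left (by exact_mod_cast h) hr)

lemma ceilMul_add_le (r : ℚ) (x y : ℤ) : ceilMul r (x + y) ≤ ceilMul r x + ceilMul r y := by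
  simpa [ceilMul, mul_add] using Int.ceil_add_le (r * (x : ℚ)) (r * (y : ℚ))

lemma ceilMul_add_ceilMul_le (r : ℚ) (x y : ℤ) :
    ceilMul r x + ceilMul r y ≤ ceilMul r (x + y) + 1 := by
  simpa [ceilMul, mul_add] using Int.ceil_add_ceil_le (r * (x : ℚ)) (r * (y : ℚ))

/-- If `r * p` is an integer, then `ceilMul r` is additive along multiples of `p`. -/
lemma ceilMul_add_of_dvd {r : ℚ} {p q : ℤ} (h : r * p = q) {x : ℤ} (hx : p ∣ x) (y : ℤ) :
    ceilMul r (x + y) = ceilMul r x + ceilMul r y := by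
  obtain ⟨k, rfl⟩ := hx
  have hk : r * ((p * k : ℤ) : ℚ) = ((q * k : ℤ) : ℚ) := by
    push_cast
    rw [← mul_assoc, h]
  have hadd : r * ((p * k + y : ℤ) : ℚ) = ((q * k : ℤ) : ℚ) + r * y := by
    rw [← hk]
    push_cast
    ring
  simp only [ceilMul, hk, hadd, Int.ceil_intCast, Int.ceil_intCast_add]

lemma maximalFreq_eq (L : ℕ) (r : ℚ) (m : ℕ) :
    maximalFreq L r m = (ceilMul r (L - m + 1) - ceilMul r (L - m)).toNat := by
  simp [maximalFreq, ceilMul]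

/-- The excess of the bank deposit over its initial value after `i` moves of Austrian Solitaire
started at a balanced partition. -/
def bankExcess (L : ℕ) (r : ℚ) (i : ℕ) : ℤ :=
  ∑ j ∈ Finset.range L,
    (ceilMul r ((j : ℤ) + 1) + ceilMul r (-i) - ceilMul r ((j : ℤ) + 1 + -i))

lemma bankExcess_nonneg (L : ℕ) (r : ℚ) (i : ℕ) : 0 ≤ bankExcess L r i :=
  Finset.sum_nonneg fun _ _ => sub_nonneg.2 (ceilMul_add_le r _ _)

lemma bankExcess_add_div_le {L p : ℕ} {r : ℚ} {q : ℤ} (h : r * (p : ℤ) = q) (i : ℕ) :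
    bankExcess L r i + (L / p : ℕ) ≤ L := by
  rw [bankExcess, ← Nat.card_multiples L p, Finset.card_filter]
  push_cast
  rw [← Finset.sum_add_distrib]
  calc _ ≤ ∑ _j ∈ Finset.range L, (1 : ℤ) := by
        refine Finset.sum_le_sum fun j _ => ?_
        split_ifs with hj
        · have := ceilMul_add_of_dvd h (x := (j : ℤ) + 1) (by exact_mod_cast hj) (-i)
          omega
        · have := ceilMul_add_ceilMul_le r ((j : ℤ) + 1) (-i)
          omega
    _ = L := by simp

lemma bankExcess_zero (L : ℕ) (r : ℚ) : bankExcess L r 0 = 0 := by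
  simp [bankExcess, ceilMul_zero]

lemma bankExcess_period {L p : ℕ} {r : ℚ} {q : ℤ} (h : r * (p : ℤ) = q) :
    bankExcess L r p = 0 := by
  refine Finset.sum_eq_zero fun j _ => ?_
  have := ceilMul_add_of_dvd h (x := -(p : ℤ)) (by simp) ((j : ℤ) + 1)
  rw [add_comm ((j : ℤ) + 1), this]
  ring

lemma bankExcess_succ (L : ℕ) (r : ℚ) (i : ℕ) :
    bankExcess L r i + (ceilMul r (L - i) - ceilMul r (-i)) =
      bankExcess L r (i + 1) + L * (ceilMul r (-i) - ceilMul r (-i - 1)) := by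
  have htel := Finset.sum_range_sub (fun j : ℕ => ceilMul r ((j : ℤ) - i)) L
  have hdiff : bankExcess L r (i + 1) - bankExcess L r i =
      ∑ j ∈ Finset.range L, (ceilMul r (((j + 1 : ℕ) : ℤ) - i) - ceilMul r ((j : ℤ) - i)) -
        L * (ceilMul r (-i) - ceilMul r (-i - 1)) := by
    have hconst : (L : ℤ) * (ceilMul r (-i) - ceilMul r (-i - 1)) =
        ∑ _j ∈ Finset.range L, (ceilMul r (-i) - ceilMul r (-i - 1)) := by
      rw [Finset.sum_const, Finset.card_range, nsmul_eq_mul]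
    rw [hconst, bankExcess, bankExcess, ← Finset.sum_sub_distrib, ← Finset.sum_sub_distrib]
    refine Finset.sum_congr rfl fun j _ => ?_
    have h₁ : (j : ℤ) + 1 + -((i + 1 : ℕ) : ℤ) = j - i := by push_cast; ring
    have h₂ : -((i + 1 : ℕ) : ℤ) = -i - 1 := by push_cast; ring
    have h₃ : (((j + 1 : ℕ) : ℤ) - i) = j + 1 + -i := by push_cast; ring
    rw [h₁, h₂, h₃]
    ring
  simp only [Nat.cast_zero, zero_sub] at htel
  linarith

/-- The state reached from `balancedPartition L r b` after `i` moves. -/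
def balancedOrbit (L : ℕ) (r : ℚ) (b i : ℕ) : ℕ → ℕ := fun m =>
  if m = 0 then (b + bankExcess L r i).toNat
  else if m ≤ L then (ceilMul r (L - m + 1 - i) - ceilMul r (L - m - i)).toNat else 0

lemma balancedOrbit_zero (L : ℕ) (r : ℚ) (b : ℕ) :
    balancedOrbit L r b 0 = balancedPartition L r b := by
  funext m
  simp [balancedOrbit, balancedPartition, bankExcess_zero, maximalFreq_eq]

lemma balancedOrbit_period {L p : ℕ} {r : ℚ} {q : ℤ} (h : r * (p : ℤ) = q) (b : ℕ) :
    balancedOrbit L r b p = balancedPartition L r b := by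
  funext m
  have hp : ∀ x : ℤ, ceilMul r (x - p) = ceilMul r (-p) + ceilMul r x := fun x => by
    rw [sub_eq_neg_add, ceilMul_add_of_dvd h (by simp)]
  simp [balancedOrbit, balancedPartition, bankExcess_period h, maximalFreq_eq, hp]

lemma sum_Icc_one_sub (F : ℤ → ℤ) (n : ℕ) :
    ∑ m ∈ Finset.Icc 1 n, (F ((m : ℤ) - 1) - F m) = F 0 - F n := by
  induction n with
  | zero => simp
  | succ n ih =>
    rw [Finset.sum_Icc_succ_top (by omega), ih]
    push_cast
    rw [add_sub_cancel_right]
    ring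

lemma austrianT_balancedOrbit {r : ℚ} (hr : 0 ≤ r) (L b i : ℕ) :
    (austrianT L (balancedOrbit L r b i) : ℤ) = ceilMul r (L - i) - ceilMul r (-i) := by
  have htel := sum_Icc_one_sub (fun x => ceilMul r (L - x - i)) L
  simp only [sub_zero, sub_self, zero_sub] at htel
  rw [← htel, austrianT]
  push_cast
  refine Finset.sum_congr rfl fun m hm => ?_
  rw [Finset.mem_Icc] at hm
  have hle : ceilMul r (L - m - i) ≤ ceilMul r (L - m + 1 - i) := ceilMul_mono hr (by omega)
  rw [balancedOrbit, if_neg (by omega), if_pos hm.2, Int.toNat_of_nonneg (by omega),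
    sub_sub_eq_add_sub, add_sub_right_comm (L : ℤ)]

lemma austrianStep_balancedOrbit {L p b : ℕ} {r : ℚ} {q : ℤ} (hr : 0 ≤ r) (hL : 1 ≤ L)
    (h : r * (p : ℤ) = q) (hb : b < L / p) (i : ℕ) :
    austrianStep L (balancedOrbit L r b i) = balancedOrbit L r b (i + 1) := by
  have hT := austrianT_balancedOrbit hr L b i
  have hsucc := bankExcess_succ L r i
  have hnonneg := bankExcess_nonneg L r
  have hle : ceilMul r (-i - 1) ≤ ceilMul r (-i) := ceilMul_mono hr (by omega)
  have hlt := bankExcess_add_div_le (L := L) h (i + 1)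
  obtain ⟨u, hu⟩ := Int.eq_ofNat_of_zero_le (hnonneg (i + 1))
  obtain ⟨v, hv⟩ := Int.eq_ofNat_of_zero_le (hnonneg i)
  obtain ⟨f, hf⟩ := Int.eq_ofNat_of_zero_le (sub_nonneg.2 hle)
  have hbank : balancedOrbit L r b i 0 = b + v := by
    simp only [balancedOrbit, if_true, hv]
    omega
  have hu_lt : b + u < L := by omega
  have htotal : balancedOrbit L r b i 0 + austrianT L (balancedOrbit L r b i) =
      (b + u) + L * f := by
    rw [hbank]
    zify
    rw [hT]
    rw [hu, hv, hf] at hsucc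
    linarith
  funext m
  rw [austrianStep, htotal]
  split_ifs with h₀ h₁ h₂
  · rw [Nat.add_mul_mod_self_left, Nat.mod_eq_of_lt hu_lt]
    simp only [balancedOrbit, h₀, if_true, hu]
    omega
  · subst h₁
    rw [Nat.add_mul_div_left _ _ (by omega), Nat.div_eq_of_lt hu_lt, zero_add]
    have e₁ : (m : ℤ) - m + 1 - ((i + 1 : ℕ) : ℤ) = -i := by push_cast; ring
    have e₂ : (m : ℤ) - m - ((i + 1 : ℕ) : ℤ) = -i - 1 := by push_cast; ring
    rw [balancedOrbit, if_neg h₀, if_pos le_rfl, e₁, e₂, hf]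
    rfl
  · have e₁ : (L : ℤ) - (m + 1 : ℕ) + 1 - i = L - m + 1 - (i + 1 : ℕ) := by push_cast; ring
    have e₂ : (L : ℤ) - (m + 1 : ℕ) - i = L - m - (i + 1 : ℕ) := by push_cast; ring
    rw [balancedOrbit, balancedOrbit, if_neg (by omega), if_pos (by omega), if_neg h₀,
      if_pos h₂.le, e₁, e₂]
  · rw [balancedOrbit, if_neg h₀, if_neg (by omega)]

lemma isAustrian_balancedPartition {L b : ℕ} (r : ℚ) (hb : b < L) :
    IsAustrian (b + ∑ m ∈ Finset.Icc 1 L, m * maximalFreq L r m) L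
      (balancedPartition L r b) := by
  refine ⟨hb, fun m hm => ?_, ?_⟩
  · rw [balancedPartition, if_neg (by omega), if_neg (by omega)]
  · refine congrArg (b + ·) (Finset.sum_congr rfl fun m hm => ?_)
    rw [Finset.mem_Icc] at hm
    rw [balancedPartition, if_neg (by omega), if_pos hm.2]

/-- For coprime `q ≥ 0`, `1 ≤ p ≤ L` and bank deposit `0 ≤ b < ⌊L/p⌋`, the
partition `λ` with bank `b` and `f_m(λ) = ⌈(q/p)(L-m+1)⌉ - ⌈(q/p)(L-m)⌉` lies in
`𝒜(n,L)` for `n = b + ∑_{m=1}^L m·f_m(λ)` and is periodic: `A^p λ = λ`. -/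
theorem balanced_is_periodic (L q p b : ℕ) (hL : 1 ≤ L) (hp : 1 ≤ p) (hpL : p ≤ L)
    (hcop : Nat.Coprime q p) (hb : b < L / p) :
    IsAustrian (b + ∑ m ∈ Finset.Icc 1 L, m * maximalFreq L ((q : ℚ) / (p : ℚ)) m) L
      (balancedPartition L ((q : ℚ) / (p : ℚ)) b) ∧
    (austrianStep L)^[p] (balancedPartition L ((q : ℚ) / (p : ℚ)) b) =
      balancedPartition L ((q : ℚ) / (p : ℚ)) b := by
  have hr : (0 : ℚ) ≤ (q : ℚ) / p := by positivity
  have h : (q : ℚ) / p * ((p : ℤ) : ℚ) = ((q : ℤ) : ℚ) := by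
    have : (p : ℚ) ≠ 0 := by positivity
    push_cast
    field_simp
  refine ⟨isAustrian_balancedPartition _ (hb.trans_le (Nat.div_le_self L p)), ?_⟩
  have hiter : ∀ i, (austrianStep L)^[i] (balancedPartition L ((q : ℚ) / p) b) =
      balancedOrbit L ((q : ℚ) / p) b i := by
    intro i
    induction i with
    | zero => exact (balancedOrbit_zero L _ b).symm
    | succ i ih =>
      rw [Function.iterate_succ_apply', ih, austrianStep_balancedOrbit hr hL h hb]
  rw [hiter, balancedOrbit_period h]
end

section
/- Let q ≥ 0 and p ≥ 1 be coprime integers and let γ : ℤ → ℤ be defined by γ_i = ⌈q(i+1)/p⌉ − ⌈q i/p⌉. Then there exists an integer j ≥ 1 such that for every integer k ≥ 1, ∑_{i=0}^{k−1} γ_{j+i} = ⌊qk/p⌋. -/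
/-- The maximal balanced sequence `γ^{q/p} : ℤ → ℤ`,
`γ_i = ⌈q(i+1)/p⌉ - ⌈q i/p⌉`. -/
def balGamma (q p : ℕ) (i : ℤ) : ℤ :=
  ⌈(q : ℚ) * ((i : ℚ) + 1) / (p : ℚ)⌉ - ⌈(q : ℚ) * (i : ℚ) / (p : ℚ)⌉

theorem sum_range_balGamma (q p : ℕ) (j : ℤ) (k : ℕ) :
    ∑ i ∈ Finset.range k, balGamma q p (j + (i : ℤ)) =
      ⌈(q : ℚ) * ((j : ℚ) + k) / (p : ℚ)⌉ - ⌈(q : ℚ) * (j : ℚ) / (p : ℚ)⌉ := by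
  have h := Finset.sum_range_sub (fun i : ℕ => ⌈(q : ℚ) * ((j : ℚ) + i) / (p : ℚ)⌉) k
  simpa [balGamma, add_assoc] using h

theorem ceil_intCast_add_one_div_natCast {p : ℕ} (hp : 1 ≤ p) (n : ℤ) :
    ⌈((n : ℚ) + 1) / (p : ℚ)⌉ = ⌊(n : ℚ) / (p : ℚ)⌋ + 1 := by
  have hp0 : (0 : ℚ) < p := by exact_mod_cast hp
  have hle := Int.floor_le ((n : ℚ) / p)
  have hlt := Int.lt_floor_add_one ((n : ℚ) / p)
  rw [le_div_iff₀ hp0] at hle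
  rw [div_lt_iff₀ hp0] at hlt
  have hlt' : (n : ℚ) + 1 ≤ (⌊(n : ℚ) / p⌋ + 1) * p := by exact_mod_cast hlt
  rw [Int.ceil_eq_iff]
  push_cast
  rw [lt_div_iff₀ hp0, div_le_iff₀ hp0]
  constructor <;> linarith

theorem exists_pos_mul_eq_one_add_mul {q p : ℕ} (hp : 1 ≤ p) (hcop : Nat.Coprime q p) :
    ∃ j m : ℤ, 1 ≤ j ∧ (q : ℤ) * j = 1 + p * m := by
  obtain ⟨a, b, hab⟩ := Nat.isCoprime_iff_coprime.mpr hcop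
  refine ⟨a + p * (|a| + 1), q * (|a| + 1) - b, ?_, by linear_combination hab⟩
  have hp1 : (1 : ℤ) ≤ p := by exact_mod_cast hp
  nlinarith [neg_abs_le a, abs_nonneg a]

/-- For coprime `q ≥ 0`, `p ≥ 1`, there is a shift `j ≥ 1` of the maximal balanced
sequence `γ` whose partial sums realize the floor: `∑_{i<k} γ_{j+i} = ⌊qk/p⌋` for
all `k ≥ 1`. -/
theorem balGamma_floor_shift (q p : ℕ) (hp : 1 ≤ p) (hcop : Nat.Coprime q p) :
    ∃ j : ℤ, 1 ≤ j ∧ ∀ k : ℕ, 1 ≤ k →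
      ∑ i ∈ Finset.range k, balGamma q p (j + (i : ℤ)) =
        ⌊(q : ℚ) * (k : ℚ) / (p : ℚ)⌋ := by
  obtain ⟨j, m, hj, hqj⟩ := exists_pos_mul_eq_one_add_mul hp hcop
  have hp0 : (p : ℚ) ≠ 0 := by exact_mod_cast Nat.one_le_iff_ne_zero.mp hp
  have hqj' : (q : ℚ) * j = 1 + p * m := by exact_mod_cast hqj
  have hceil (k : ℕ) :
      ⌈(q : ℚ) * ((j : ℚ) + k) / (p : ℚ)⌉ = ⌊(q : ℚ) * (k : ℚ) / (p : ℚ)⌋ + 1 + m := by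
    have hsplit : (q : ℚ) * ((j : ℚ) + k) / p = (((q * k : ℤ) : ℚ) + 1) / p + m := by
      rw [mul_add, hqj']
      push_cast
      field_simp
      ring
    rw [hsplit, Int.ceil_add_intCast, ceil_intCast_add_one_div_natCast hp]
    push_cast
    rfl
  refine ⟨j, hj, fun k _ => ?_⟩
  have hzero := hceil 0
  simp only [Nat.cast_zero, add_zero, mul_zero, zero_div, Int.floor_zero] at hzero
  rw [sum_range_balGamma, hceil, hzero]
  ring
end

section
/- Suppose λ ∈ 𝒜(n,L) satisfies A^P(λ) = λ for some P ≥ 1, and define β : ℤ → ℕ by β_i = f_L(A^{(−i) mod P}(λ)). Then ∑_{k=1}^{L} ∑_{i=0}^{k−1} β_i = ∑_{m=1}^{L} m·f_m(λ) = n − λ_0, where λ_0 is the bank deposit of λ. -/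
/-- Parts created with value `L` have value `L - j` after `j` further moves. -/
lemma austrianStep_iterate_apply_sub (L : ℕ) {j : ℕ} (hj : j < L) (τ : ℕ → ℕ) :
    ((austrianStep L)^[j] τ) (L - j) = τ L := by
  induction j with
  | zero => rfl
  | succ j ih =>
    rw [Function.iterate_succ_apply', austrianStep, if_neg (by omega), if_neg (by omega),
      if_pos (by omega), show L - (j + 1) + 1 = L - j by omega]
    exact ih (by omega)

/-- A periodic state is determined by the parts created along its orbit. -/
lemma iterate_neg_emod_apply_eq {L P : ℕ} (hP : 1 ≤ P) {σ : ℕ → ℕ}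
    (hper : (austrianStep L)^[P] σ = σ) {i : ℕ} (hi : i < L) :
    ((austrianStep L)^[((-(i : ℤ)) % (P : ℤ)).toNat] σ) L = σ (L - i) := by
  have hP' : (P : ℤ) ≠ 0 := by omega
  have hdvd : P ∣ i + ((-(i : ℤ)) % (P : ℤ)).toNat := by
    zify
    rw [Int.toNat_of_nonneg (Int.emod_nonneg _ hP')]
    refine ⟨-(-(i : ℤ) / P), ?_⟩
    linarith [Int.mul_ediv_add_emod (-(i : ℤ)) P]
  have hfix : (austrianStep L)^[i + ((-(i : ℤ)) % (P : ℤ)).toNat] σ = σ :=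
    Function.IsPeriodicPt.trans_dvd (f := austrianStep L) hper hdvd
  rw [← austrianStep_iterate_apply_sub L hi ((austrianStep L)^[_] σ),
    ← Function.iterate_add_apply, hfix]

lemma sum_Icc_sum_range_sub (L : ℕ) (f : ℕ → ℕ) :
    ∑ k ∈ Finset.Icc 1 L, ∑ i ∈ Finset.range k, f (L - i) = ∑ m ∈ Finset.Icc 1 L, m * f m := by
  have hswap : ∑ k ∈ Finset.Icc 1 L, ∑ i ∈ Finset.range k, f (L - i) =
      ∑ i ∈ Finset.range L, ∑ _k ∈ Finset.Icc (i + 1) L, f (L - i) :=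
    Finset.sum_comm' fun k i => by simp only [Finset.mem_Icc, Finset.mem_range]; omega
  rw [hswap]
  refine Finset.sum_bij' (fun i _ => L - i) (fun m _ => L - m) ?_ ?_ ?_ ?_ ?_ <;>
    simp only [Finset.mem_Icc, Finset.mem_range, Finset.sum_const, Nat.card_Icc, smul_eq_mul,
      Nat.add_sub_add_right, implies_true] <;>
    omega

/-- For periodic `λ ∈ 𝒜(n,L)` with `A^P λ = λ` and `β_i = f_L(A^{(-i) mod P} λ)`,
the sum of partial sums recovers the non-bank total:
`∑_{k=1}^L ∑_{i=0}^{k-1} β_i = ∑_{m=1}^L m·f_m(λ) = n - λ₀`. -/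
theorem sum_partial_sums_eq (n L P : ℕ) (hL : 1 ≤ L) (hP : 1 ≤ P) (σ : ℕ → ℕ)
    (hσ : IsAustrian n L σ) (hper : (austrianStep L)^[P] σ = σ) :
    (∑ k ∈ Finset.Icc 1 L, ∑ i ∈ Finset.range k,
        ((austrianStep L)^[((-(i : ℤ)) % (P : ℤ)).toNat] σ) L) =
      ∑ m ∈ Finset.Icc 1 L, m * σ m ∧
    (∑ k ∈ Finset.Icc 1 L, ∑ i ∈ Finset.range k,
        ((austrianStep L)^[((-(i : ℤ)) % (P : ℤ)).toNat] σ) L) = n - σ 0 := by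
  have hsum : (∑ k ∈ Finset.Icc 1 L, ∑ i ∈ Finset.range k,
      ((austrianStep L)^[((-(i : ℤ)) % (P : ℤ)).toNat] σ) L) =
      ∑ m ∈ Finset.Icc 1 L, m * σ m := by
    rw [← sum_Icc_sum_range_sub]
    refine Finset.sum_congr rfl fun k hk => Finset.sum_congr rfl fun i hi => ?_
    rw [Finset.mem_Icc] at hk
    rw [Finset.mem_range] at hi
    exact iterate_neg_emod_apply_eq hP hper (by omega)
  exact ⟨hsum, by rw [hsum, ← hσ.2.2, Nat.add_sub_cancel_left]⟩
end

section
/- Let p ≥ 1 be an integer and let β : ℤ → ℕ be a p-periodic sequence (β_{i+p} = β_i for all i), and set q = ∑_{i=0}^{p−1} β_i. Then there exists an integer j such that for every integer k ≥ 1, ∑_{i=0}^{k−1} β_{j+i} ≥ ⌈qk/p⌉. -/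
/-- A periodic function on `ℕ` with values in a linear order attains its minimum. -/
theorem Function.Periodic.exists_forall_le_nat {α : Type*} [LinearOrder α] {f : ℕ → α} {p : ℕ}
    (hf : Function.Periodic f p) (hp : 0 < p) : ∃ m, ∀ n, f m ≤ f n := by
  obtain ⟨m, -, hm⟩ := Finset.exists_min_image (Finset.range p) f ⟨0, Finset.mem_range.2 hp⟩
  refine ⟨m, fun n => ?_⟩
  rw [← hf.map_mod_nat n]
  exact hm _ (Finset.mem_range.2 (Nat.mod_lt n hp))

/-- **Raney-type lemma.**  If `β : ℤ → ℕ` is `p`-periodic with `q = ∑_{i<p} β_i`,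
then there is a shift `j` with `∑_{i<k} β_{j+i} ≥ ⌈qk/p⌉` for every `k ≥ 1`. -/
theorem raney_shift (p : ℕ) (hp : 1 ≤ p) (β : ℤ → ℕ)
    (hper : ∀ i : ℤ, β (i + (p : ℤ)) = β i) (q : ℕ)
    (hq : q = ∑ i ∈ Finset.range p, β (i : ℤ)) :
    ∃ j : ℤ, ∀ k : ℕ, 1 ≤ k →
      ⌈(q : ℚ) * (k : ℚ) / (p : ℚ)⌉ ≤
        ∑ i ∈ Finset.range k, (β (j + (i : ℤ)) : ℤ) := by
  have hF : Function.Periodic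
      (fun n : ℕ => (p : ℤ) * ∑ i ∈ Finset.range n, (β (i : ℤ) : ℤ) - q * n) p := by
    intro n
    have hshift : ∀ i : ℕ, β (((p + i : ℕ) : ℤ)) = β i := fun i => by
      rw [← hper i]; push_cast; rw [add_comm]
    have hq' : (q : ℤ) = ∑ i ∈ Finset.range p, (β (i : ℤ) : ℤ) := by exact_mod_cast hq
    simp only [add_comm n p, Finset.sum_range_add, hshift, ← hq']
    push_cast
    ring
  obtain ⟨m, hm⟩ := hF.exists_forall_le_nat hp
  refine ⟨m, fun k _ => ?_⟩
  have h := hm (m + k)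
  simp only [Finset.sum_range_add] at h
  push_cast at h
  have hk : (q : ℤ) * k ≤ (∑ i ∈ Finset.range k, (β ((m : ℤ) + (i : ℤ)) : ℤ)) * p := by
    linarith
  rw [Int.ceil_le, div_le_iff₀ (by exact_mod_cast hp)]
  exact_mod_cast hk
end

section
/- Let L ≥ 1, p ≥ 1 be integers, let ω : ℤ → ℕ be p-periodic with q = ∑_{i=0}^{p−1} ω_i, and let γ : ℤ → ℤ be given by γ_i = ⌈q(i+1)/p⌉ − ⌈q i/p⌉. Suppose ∑_{i=0}^{k−1} ω_i ≥ ⌈qk/p⌉ for every k ≥ 1, and ω ≠ γ. Then there exists an integer J with 1 ≤ J ≤ p−1 such that ∑_{k=1}^{L} ∑_{i=0}^{k−1} (ω_i − ω_{J+i}) ≥ L. -/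
/-- The sum `E k + E (k - s) + E (k - 2 s) + ⋯` over the positive arguments. -/
def stepSum (s : ℕ) (E : ℕ → ℤ) (k : ℕ) : ℤ :=
  if _ : 0 < s ∧ s < k then E k + stepSum s E (k - s) else E k
termination_by k
decreasing_by omega

theorem stepSum_of_le {s k : ℕ} (E : ℕ → ℤ) (h : k ≤ s) : stepSum s E k = E k := by
  rw [stepSum, dif_neg (by omega)]

theorem stepSum_of_lt {s k : ℕ} (E : ℕ → ℤ) (hs : 0 < s) (h : s < k) :
    stepSum s E k = E k + stepSum s E (k - s) := by
  rw [stepSum, dif_pos ⟨hs, h⟩]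

theorem sum_Icc_add_sum_stepSum {s : ℕ} (E : ℕ → ℤ) (hs : 0 < s) (L : ℕ) :
    ∑ k ∈ Finset.Icc 1 L, E k + ∑ k ∈ Finset.Icc 1 (L - s), stepSum s E k =
      ∑ k ∈ Finset.Icc 1 L, stepSum s E k := by
  induction L with
  | zero => simp
  | succ L ih =>
    rw [Finset.sum_Icc_succ_top (by omega), Finset.sum_Icc_succ_top (by omega)]
    rcases le_or_gt (L + 1) s with h | h
    · rw [stepSum_of_le E h, ← ih, Nat.sub_eq_zero_of_le h, Nat.sub_eq_zero_of_le (by omega)]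
      simp
    · rw [stepSum_of_lt E hs h, show L + 1 - s = L - s + 1 by omega,
        Finset.sum_Icc_succ_top (by omega)]
      linarith

theorem sum_Icc_nonneg_of_stepSum_nonneg {s : ℕ} {E : ℕ → ℤ} (hs : 0 < s)
    (h : ∀ k, 1 ≤ k → 0 ≤ stepSum s E k) (L : ℕ) : 0 ≤ ∑ k ∈ Finset.Icc 1 L, E k := by
  have h1 := sum_Icc_add_sum_stepSum E hs L
  have h2 : ∑ k ∈ Finset.Icc 1 (L - s), stepSum s E k ≤ ∑ k ∈ Finset.Icc 1 L, stepSum s E k :=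
    Finset.sum_le_sum_of_subset_of_nonneg (Finset.Icc_subset_Icc_right (Nat.sub_le L s))
      fun k hk _ => h k (Finset.mem_Icc.mp hk).1
  linarith

/-- Let `d k = p * S k - q * k` be `p`-periodic and nonnegative with `d 0 = 0`. If `J` is the last
maximizer of `d` in `[0, p)` and `p ≤ d J`, the averaged defect of `S` at `J` is at least one. -/
theorem le_sum_defect_of_last_max {p q J : ℕ} {S : ℕ → ℤ} (hJ : J < p)
    (h0 : S 0 = 0) (hper : ∀ k, S (k + p) = S k + q)
    (hnonneg : ∀ k : ℕ, (q : ℤ) * k ≤ p * S k)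
    (hmax : ∀ j, J < j → j < p → (p : ℤ) * S j - q * j < p * S J - q * J)
    (hlarge : (p : ℤ) ≤ p * S J - q * J) (L : ℕ) :
    (L : ℤ) ≤ ∑ k ∈ Finset.Icc 1 L, (S k - (S (J + k) - S J)) := by
  have hp : (0 : ℤ) < p := by omega
  obtain ⟨s, hs, rfl⟩ : ∃ s, 0 < s ∧ p = J + s := ⟨p - J, by omega, by omega⟩
  set E : ℕ → ℤ := fun k => S k - (S (J + k) - S J) - 1 with hE
  have hlow : ∀ k, 1 ≤ k →
      ((J + s : ℕ) : ℤ) * S k - q * k - (J + s : ℕ) < (J + s : ℕ) * stepSum s E k := by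
    intro k
    induction k using Nat.strong_induction_on with
    | _ k ih =>
      intro hk
      rcases le_or_gt k s with h | h
      · rw [stepSum_of_le E h, hE]
        rcases h.lt_or_eq with h | rfl
        · have := hmax (J + k) (by omega) (by omega)
          push_cast at *
          linarith
        · have := hper 0
          rw [zero_add, h0] at this
          simp only [this]
          push_cast at *
          linarith
      · rw [stepSum_of_lt E hs h]
        obtain ⟨m, rfl⟩ : ∃ m, k = m + s := ⟨k - s, by omega⟩
        have h1 := ih m (by omega) (by omega)
        have h2 := hper m
        rw [Nat.add_sub_cancel]
        have h3 : E (m + s) = S (m + s) - (S m + q - S J) - 1 := by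
          rw [hE, ← h2]; simp only [Nat.add_left_comm]
        rw [h3]
        push_cast at *
        linarith
  have key := sum_Icc_nonneg_of_stepSum_nonneg (E := E) hs (fun k hk => by
    have h1 := hlow k hk
    have h2 := hnonneg k
    by_contra! hlt
    nlinarith) L
  simp only [hE, Finset.sum_sub_distrib (g := fun _ => (1 : ℤ)), Finset.sum_const,
    Nat.card_Icc] at key
  simpa using key

theorem exists_last_max (d : ℕ → ℤ) {p : ℕ} (hp : 0 < p) :
    ∃ J < p, (∀ j < p, d j ≤ d J) ∧ ∀ j, J < j → j < p → d j < d J := by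
  obtain ⟨J, hJ, hmax⟩ := Finset.exists_max_image (Finset.range p)
    (fun j => toLex (d j, j)) ⟨0, by simpa using hp⟩
  refine ⟨J, by simpa using hJ, fun j hj => ?_, fun j hJj hj => ?_⟩ <;>
  · have := hmax j (by simpa using hj)
    rw [Prod.Lex.toLex_le_toLex] at this
    dsimp only at this
    omega

theorem balGamma_add_mul {p : ℕ} (hp : 0 < p) (q : ℕ) (i m : ℤ) :
    balGamma q p (i + p * m) = balGamma q p i := by
  have hp' : (p : ℚ) ≠ 0 := by positivity
  have h1 : (q : ℚ) * ((i + p * m : ℤ) + 1) / p = q * (i + 1) / p + (q * m : ℤ) := by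
    push_cast; field_simp; ring
  have h2 : (q : ℚ) * (i + p * m : ℤ) / p = q * i / p + (q * m : ℤ) := by
    push_cast; field_simp
  rw [balGamma, h1, h2, Int.ceil_add_intCast, Int.ceil_add_intCast, balGamma]
  ring

/-- If a `p`-periodic `ω : ℤ → ℕ` with `q = ∑_{i<p} ω_i` dominates the ceiling
(`∑_{i<k} ω_i ≥ ⌈qk/p⌉` for all `k ≥ 1`) but differs from the maximal balanced
sequence `γ`, then for some `1 ≤ J ≤ p-1`,
`∑_{k=1}^L ∑_{i=0}^{k-1} (ω_i - ω_{J+i}) ≥ L`. -/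
theorem imbalanced_defect (L p : ℕ) (hL : 1 ≤ L) (hp : 1 ≤ p) (ω : ℤ → ℕ)
    (hper : ∀ i : ℤ, ω (i + (p : ℤ)) = ω i) (q : ℕ)
    (hq : q = ∑ i ∈ Finset.range p, ω (i : ℤ))
    (hdom : ∀ k : ℕ, 1 ≤ k →
      ⌈(q : ℚ) * (k : ℚ) / (p : ℚ)⌉ ≤ ∑ i ∈ Finset.range k, (ω (i : ℤ) : ℤ))
    (hne : ¬ ∀ i : ℤ, (ω i : ℤ) = balGamma q p i) :
    ∃ J : ℕ, 1 ≤ J ∧ J ≤ p - 1 ∧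
      (L : ℤ) ≤ ∑ k ∈ Finset.Icc 1 L, ∑ i ∈ Finset.range k,
        ((ω (i : ℤ) : ℤ) - (ω ((J : ℤ) + (i : ℤ)) : ℤ)) := by
  have hp0 : (0 : ℚ) < p := by exact_mod_cast hp
  set S : ℕ → ℤ := fun k => ∑ i ∈ Finset.range k, (ω i : ℤ) with hS
  have hSadd : ∀ J k : ℕ, S (J + k) - S J = ∑ i ∈ Finset.range k, (ω ((J : ℤ) + i) : ℤ) := by
    intro J k
    simp only [hS, Finset.sum_range_add, add_sub_cancel_left, Nat.cast_add]
  have hSper : ∀ k, S (k + p) = S k + q := by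
    intro k
    have h : S p = q := by simp [hS, hq]
    have h' := hSadd p k
    simp only [add_comm (p : ℤ), hper] at h'
    rw [add_comm k p]
    linarith
  have hceil : ∀ k : ℕ, ⌈(q : ℚ) * k / p⌉ ≤ S k := by
    intro k
    rcases k.eq_zero_or_pos with rfl | hk
    · simp [hS]
    · exact hdom k hk
  have hnonneg : ∀ k : ℕ, (q : ℤ) * k ≤ p * S k := by
    intro k
    have h := Int.ceil_le.mp (hceil k)
    rw [div_le_iff₀ hp0] at h
    have h' : (q : ℤ) * k ≤ S k * p := by exact_mod_cast h
    linarith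
  have hmod : ∀ (n : ℕ), (p : ℤ) * S (n % p) - q * (n % p : ℕ) = p * S n - q * n := by
    intro n
    induction n using Nat.strong_induction_on with
    | _ n ih =>
      rcases lt_or_ge n p with h | h
      · rw [Nat.mod_eq_of_lt h]
      · obtain ⟨m, rfl⟩ : ∃ m, n = m + p := ⟨n - p, by omega⟩
        rw [Nat.add_mod_right, ih m (by omega), hSper]
        push_cast
        ring
  obtain ⟨n, hn⟩ : ∃ n : ℕ, ⌈(q : ℚ) * n / p⌉ < S n := by
    by_contra! hle
    have heq : ∀ n : ℕ, S n = ⌈(q : ℚ) * n / p⌉ := fun n => le_antisymm (hle n) (hceil n)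
    have hωγ : ∀ n : ℕ, (ω n : ℤ) = balGamma q p n := by
      intro n
      have h1 := heq (n + 1)
      have h2 := heq n
      have h3 : S (n + 1) = S n + ω n := Finset.sum_range_succ _ _
      rw [balGamma]
      push_cast at *
      linarith
    refine hne fun i => ?_
    have hi : i % p + p * (i / p) = i := Int.emod_add_mul_ediv i p
    obtain ⟨r, hr⟩ := Int.eq_ofNat_of_zero_le (Int.emod_nonneg i (b := p) (by omega))
    have hωi : ω i = ω (i % p) := by
      have h := Function.Periodic.int_mul (f := ω) (c := (p : ℤ)) hper (i / p) (i % p)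
      rwa [Int.cast_id, mul_comm, hi] at h
    have hγi := balGamma_add_mul hp q (i % p) (i / p)
    rw [hi, hr, ← hωγ, ← hr] at hγi
    rw [hωi, hγi]
  have hn' : (p : ℤ) ≤ p * S n - q * n := by
    have h : ⌈(q : ℚ) * n / p⌉ ≤ S n - 1 := by omega
    rw [Int.ceil_le, div_le_iff₀ hp0] at h
    have h' : (q : ℤ) * n ≤ (S n - 1) * p := by exact_mod_cast h
    linarith
  obtain ⟨J, hJp, hmax, hlast⟩ := exists_last_max (fun k => (p : ℤ) * S k - q * k) hp
  have hlarge : (p : ℤ) ≤ p * S J - q * J :=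
    hn'.trans ((hmod n).symm.le.trans (hmax (n % p) (Nat.mod_lt n hp)))
  refine ⟨J, ?_, by omega, ?_⟩
  · rcases J.eq_zero_or_pos with rfl | h
    · simp [hS] at hlarge
      omega
    · exact h
  · have h := le_sum_defect_of_last_max hJp (by simp [hS]) hSper hnonneg hlast hlarge L
    simpa only [hSadd, Finset.sum_sub_distrib] using h
end

section
/- Let L ≥ 1 and let q, q' ≥ 0 and p, p' ≥ 1 be integers with q·p' < q'·p (i.e., q/p < q'/p'). Then ∑_{k=1}^{L} (⌈q'k/p'⌉ − ⌈qk/p⌉) ≥ ⌊L/p⌋; in particular every summand is non-negative, and the summand is at least 1 whenever k is a multiple of p. -/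
/-- Strictly comparable slopes give strictly comparable multiples. -/
theorem mul_div_lt_mul_div_of_cross_lt {q q' p p' k : ℕ} (hp : 1 ≤ p) (hp' : 1 ≤ p')
    (hk : 1 ≤ k) (hlt : q * p' < q' * p) :
    (q : ℚ) * k / p < (q' : ℚ) * k / p' := by
  have hp0 : (0 : ℚ) < p := by exact_mod_cast hp
  have hp0' : (0 : ℚ) < p' := by exact_mod_cast hp'
  rw [div_lt_div_iff₀ hp0 hp0']
  have h : q * k * p' < q' * k * p := by
    calc q * k * p' = q * p' * k := by ring
      _ < q' * p * k := Nat.mul_lt_mul_of_pos_right hlt hk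
      _ = q' * k * p := by ring
  exact_mod_cast h


/-- If `q/p < q'/p'` (i.e. `q·p' < q'·p`) then
`∑_{k=1}^L (⌈q'k/p'⌉ - ⌈qk/p⌉) ≥ ⌊L/p⌋`; each summand is non-negative, and it is
at least `1` whenever `k` is a multiple of `p`. -/
theorem ceil_sum_ratio_lt (L q q' p p' : ℕ) (hL : 1 ≤ L) (hp : 1 ≤ p)
    (hp' : 1 ≤ p') (hlt : q * p' < q' * p) :
    ((L / p : ℕ) : ℤ) ≤ ∑ k ∈ Finset.Icc 1 L,
        (⌈(q' : ℚ) * (k : ℚ) / (p' : ℚ)⌉ - ⌈(q : ℚ) * (k : ℚ) / (p : ℚ)⌉) ∧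
    ∀ k ∈ Finset.Icc 1 L,
      0 ≤ ⌈(q' : ℚ) * (k : ℚ) / (p' : ℚ)⌉ - ⌈(q : ℚ) * (k : ℚ) / (p : ℚ)⌉ ∧
      (p ∣ k →
        1 ≤ ⌈(q' : ℚ) * (k : ℚ) / (p' : ℚ)⌉ - ⌈(q : ℚ) * (k : ℚ) / (p : ℚ)⌉) := by
  have nonneg : ∀ k ∈ Finset.Icc 1 L,
      0 ≤ ⌈(q' : ℚ) * (k : ℚ) / (p' : ℚ)⌉ - ⌈(q : ℚ) * (k : ℚ) / (p : ℚ)⌉ := fun k hk =>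
    sub_nonneg.2 <| Int.ceil_le_ceil
      (mul_div_lt_mul_div_of_cross_lt hp hp' (Finset.mem_Icc.1 hk).1 hlt).le
  have one_le : ∀ k ∈ Finset.Icc 1 L, p ∣ k →
      1 ≤ ⌈(q' : ℚ) * (k : ℚ) / (p' : ℚ)⌉ - ⌈(q : ℚ) * (k : ℚ) / (p : ℚ)⌉ := by
    intro k hk hdvd
    have hkey := mul_div_lt_mul_div_of_cross_lt hp hp' (Finset.mem_Icc.1 hk).1 hlt
    obtain ⟨m, rfl⟩ := hdvd
    have hp0 : (p : ℚ) ≠ 0 := by exact_mod_cast (Nat.one_le_iff_ne_zero.1 hp)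
    have hint : (q : ℚ) * ((p * m : ℕ) : ℚ) / p = ((q * m : ℤ) : ℚ) := by
      push_cast
      field_simp
    rw [hint] at hkey ⊢
    rw [Int.ceil_intCast]
    have := Int.lt_ceil.2 hkey
    lia
  refine ⟨?_, fun k hk => ⟨nonneg k hk, one_le k hk⟩⟩
  calc ((L / p : ℕ) : ℤ) = ∑ k ∈ Finset.Icc 1 L, if p ∣ k then (1 : ℤ) else 0 := by
        rw [Finset.sum_boole, ← Nat.Ioc_filter_dvd_card_eq_div]
        rfl
    _ ≤ _ := Finset.sum_le_sum fun k hk => by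
        split_ifs with hdvd
        · exact one_le k hk hdvd
        · exact nonneg k hk
end

section
/- Fix integers L ≥ 1 and 0 ≤ n < L. Then the Austrian partition λ^n = (n;) consisting of bank deposit n and no non-bank parts is a fixed point of the Austrian Solitaire map A, and every λ ∈ 𝒜(n,L) satisfies A^k(λ) = λ^n for all sufficiently large k; in particular λ^n is the only periodic partition in 𝒜(n,L). -/
theorem austrianT_eq_sum_range (L : ℕ) (σ : ℕ → ℕ) :
    austrianT L σ = ∑ i ∈ Finset.range L, σ (i + 1) := by
  rw [austrianT, Finset.range_eq_Ico, Finset.sum_Ico_add' σ 0 L 1]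
  rfl

theorem sum_Icc_mul_eq_sum_range (L : ℕ) (σ : ℕ → ℕ) :
    ∑ m ∈ Finset.Icc 1 L, m * σ m = ∑ i ∈ Finset.range L, (i + 1) * σ (i + 1) := by
  rw [Finset.range_eq_Ico, Finset.sum_Ico_add' (fun m => m * σ m) 0 L 1]
  rfl

namespace IsAustrian

variable {n L : ℕ} {σ : ℕ → ℕ}

theorem bank_add_austrianT_le (h : IsAustrian n L σ) : σ 0 + austrianT L σ ≤ n := by
  rw [← h.2.2, austrianT]
  gcongr with m hm
  exact Nat.le_mul_of_pos_left _ (Finset.mem_Icc.mp hm).1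

theorem austrianStep_zero (h : IsAustrian n L σ) (hn : n < L) :
    austrianStep L σ 0 = σ 0 + austrianT L σ := by
  simpa [austrianStep] using Nat.mod_eq_of_lt (h.bank_add_austrianT_le.trans_lt hn)

theorem austrianStep_of_pos (h : IsAustrian n L σ) (hn : n < L) {m : ℕ} (hm : 0 < m) :
    austrianStep L σ m = σ (m + 1) := by
  have hlt := h.bank_add_austrianT_le.trans_lt hn
  simp only [austrianStep, hm.ne', if_false]
  split_ifs with h1 h2
  · rw [Nat.div_eq_of_lt hlt, h.2.1 _ (by omega)]
  · rfl
  · rw [h.2.1 _ (by omega)]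

theorem step_s17 (h : IsAustrian n L σ) (hn : n < L) : IsAustrian n L (austrianStep L σ) := by
  refine ⟨?_, fun m hm => ?_, ?_⟩
  · rw [h.austrianStep_zero hn]
    exact h.bank_add_austrianT_le.trans_lt hn
  · rw [h.austrianStep_of_pos hn (by omega), h.2.1 _ (by omega)]
  · have hshift : ∑ i ∈ Finset.range L, (i + 1) * austrianStep L σ (i + 1) =
        ∑ i ∈ Finset.range L, i * σ (i + 1) := by
      have h1 := Finset.sum_range_succ (fun i => i * σ (i + 1)) L
      have h2 := Finset.sum_range_succ' (fun i => i * σ (i + 1)) L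
      simp only [h.2.1 (L + 1) (by omega), mul_zero, zero_mul, add_zero] at h1 h2
      rw [← h1, h2]
      exact Finset.sum_congr rfl fun i _ => by rw [h.austrianStep_of_pos hn i.succ_pos]
    have hsum := h.2.2
    rw [sum_Icc_mul_eq_sum_range] at hsum ⊢
    simp only [add_mul, one_mul, Finset.sum_add_distrib] at hsum
    rw [hshift, h.austrianStep_zero hn, austrianT_eq_sum_range]
    omega

theorem iterate_s17 (h : IsAustrian n L σ) (hn : n < L) (k : ℕ) :
    IsAustrian n L ((austrianStep L)^[k] σ) := by
  induction k with
  | zero => exact h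
  | succ k ih =>
    rw [Function.iterate_succ_apply']
    exact ih.step_s17 hn

theorem iterate_apply_of_pos (h : IsAustrian n L σ) (hn : n < L) (k : ℕ) {m : ℕ} (hm : 0 < m) :
    (austrianStep L)^[k] σ m = σ (m + k) := by
  induction k generalizing m with
  | zero => rfl
  | succ k ih =>
    rw [Function.iterate_succ_apply', (h.iterate_s17 hn k).austrianStep_of_pos hn hm, ih m.succ_pos]
    congr 1
    omega

theorem eq_of_forall_pos (h : IsAustrian n L σ) (hz : ∀ m, 0 < m → σ m = 0) :
    σ = fun m => if m = 0 then n else 0 := by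
  funext m
  split_ifs with hm
  · have hsum : ∑ m ∈ Finset.Icc 1 L, m * σ m = 0 :=
      Finset.sum_eq_zero fun i hi => by rw [hz i (Finset.mem_Icc.mp hi).1, mul_zero]
    have htotal := h.2.2
    rw [hm]
    omega
  · exact hz m (Nat.pos_of_ne_zero hm)

theorem iterate_eq (h : IsAustrian n L σ) (hn : n < L) {k : ℕ} (hk : L ≤ k) :
    (austrianStep L)^[k] σ = fun m => if m = 0 then n else 0 :=
  (h.iterate_s17 hn k).eq_of_forall_pos fun m hm => by
    rw [h.iterate_apply_of_pos hn k hm, h.2.1 _ (by omega)]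

end IsAustrian

theorem isAustrian_bank {n L : ℕ} (hn : n < L) :
    IsAustrian n L (fun m => if m = 0 then n else 0) := by
  refine ⟨by simpa using hn, fun m hm => if_neg (by omega), ?_⟩
  rw [sum_Icc_mul_eq_sum_range]
  simp

/-- For `0 ≤ n < L`, the partition `λⁿ = (n;)` (bank `n`, no non-bank parts) is a
fixed point of `A`, every `λ ∈ 𝒜(n,L)` satisfies `A^k λ = λⁿ` for all large `k`,
and `λⁿ` is the only periodic partition in `𝒜(n,L)`. -/
theorem small_n_fixed_point (n L : ℕ) (hL : 1 ≤ L) (hn : n < L) :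
    austrianStep L (fun m => if m = 0 then n else 0) =
      (fun m => if m = 0 then n else 0) ∧
    (∀ σ : ℕ → ℕ, IsAustrian n L σ → ∃ K : ℕ, ∀ k, K ≤ k →
      (austrianStep L)^[k] σ = (fun m => if m = 0 then n else 0)) ∧
    (∀ σ : ℕ → ℕ, IsAustrian n L σ → (∃ P, 1 ≤ P ∧ (austrianStep L)^[P] σ = σ) →
      σ = (fun m => if m = 0 then n else 0)) := by
  refine ⟨?_, fun σ h => ⟨L, fun k hk => h.iterate_eq hn hk⟩, ?_⟩
  · have h := isAustrian_bank hn
    exact (h.step_s17 hn).eq_of_forall_pos fun m hm => by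
      rw [h.austrianStep_of_pos hn hm, if_neg m.succ_ne_zero]
  · rintro σ h ⟨P, hP, hfix⟩
    have hfix' : (austrianStep L)^[P * L] σ = σ := by
      rw [Function.iterate_mul]
      exact Function.iterate_fixed hfix L
    rw [← h.iterate_eq hn (Nat.le_mul_of_pos_left L hP), hfix']
end
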